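/- Let λ > 0 and let ρ, J, S, φ : ℝ × ℝ → ℝ be sufficiently smooth (say four times continuously differentiable) functions of (x,t) satisfying, for all x ∈ ℝ and all t ≥ 0: (i) the continuity equation ∂_t ρ + ∂_x J = 0; (ii) the momentum equation ∂_t J + ∂_x S = ρ ∂_x φ; (iii) the reformulated Poisson equation λ² ∂_{tt} ∂_{xx} φ + ∂_x(ρ ∂_x φ) = ∂_{xx} S. Then the Poisson equation λ² ∂_{xx} φ(x,t) = ρ(x,t) − 1 holds for all x ∈ ℝ and t ≥ 0 if and only if λ² ∂_{xx} φ(x,0) = ρ(x,0) − 1 and λ² ∂_t ∂_{xx} φ(x,0) = − ∂_x J(x,0) for all x ∈ ℝ. -/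

import Mathlib

/-- Spatial partial derivative of a function of `(x, t)`. -/
noncomputable def pdx (f : ℝ × ℝ → ℝ) (x t : ℝ) : ℝ := deriv (fun y => f (y, t)) x

/-- Temporal partial derivative of a function of `(x, t)`. -/
noncomputable def pdt (f : ℝ × ℝ → ℝ) (x t : ℝ) : ℝ := deriv (fun s => f (x, s)) t

/-- Second spatial partial derivative of a function of `(x, t)`. -/
noncomputable def pdxx (f : ℝ × ℝ → ℝ) (x t : ℝ) : ℝ := deriv (fun y => pdx f y t) x

/-- `∂_t ∂_{xx}` of a function of `(x, t)`. -/
noncomputable def pdtxx (f : ℝ × ℝ → ℝ) (x t : ℝ) : ℝ := deriv (fun s => pdxx f x s) t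

/-- `∂_{tt} ∂_{xx}` of a function of `(x, t)`. -/
noncomputable def pdttxx (f : ℝ × ℝ → ℝ) (x t : ℝ) : ℝ := deriv (fun s => pdtxx f x s) t

theorem hasDerivAt_slice_fst {f : ℝ × ℝ → ℝ} (hf : Differentiable ℝ f) (x t : ℝ) :
    HasDerivAt (fun y => f (y, t)) (fderiv ℝ f (x, t) (1, 0)) x :=
  (hf (x, t)).hasFDerivAt.comp_hasDerivAt x ((hasDerivAt_id x).prodMk (hasDerivAt_const x t))

theorem hasDerivAt_slice_snd {f : ℝ × ℝ → ℝ} (hf : Differentiable ℝ f) (x t : ℝ) :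
    HasDerivAt (fun s => f (x, s)) (fderiv ℝ f (x, t) (0, 1)) t :=
  (hf (x, t)).hasFDerivAt.comp_hasDerivAt t ((hasDerivAt_const t x).prodMk (hasDerivAt_id t))

theorem pdx_eq_fderiv {f : ℝ × ℝ → ℝ} (hf : Differentiable ℝ f) :
    (fun p : ℝ × ℝ => pdx f p.1 p.2) = fun p => fderiv ℝ f p (1, 0) :=
  funext fun p => (hasDerivAt_slice_fst hf p.1 p.2).deriv

theorem pdt_eq_fderiv {f : ℝ × ℝ → ℝ} (hf : Differentiable ℝ f) :
    (fun p : ℝ × ℝ => pdt f p.1 p.2) = fun p => fderiv ℝ f p (0, 1) :=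
  funext fun p => (hasDerivAt_slice_snd hf p.1 p.2).deriv

theorem contDiff_pdx {f : ℝ × ℝ → ℝ} {m n : WithTop ℕ∞} (hf : ContDiff ℝ n f) (hmn : m + 1 ≤ n) :
    ContDiff ℝ m (fun p : ℝ × ℝ => pdx f p.1 p.2) := by
  have hn : n ≠ 0 := by
    rintro rfl
    simp at hmn
  rw [pdx_eq_fderiv (hf.differentiable hn)]
  exact (hf.fderiv_right hmn).clm_apply contDiff_const

theorem contDiff_pdt {f : ℝ × ℝ → ℝ} {m n : WithTop ℕ∞} (hf : ContDiff ℝ n f) (hmn : m + 1 ≤ n) :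
    ContDiff ℝ m (fun p : ℝ × ℝ => pdt f p.1 p.2) := by
  have hn : n ≠ 0 := by
    rintro rfl
    simp at hmn
  rw [pdt_eq_fderiv (hf.differentiable hn)]
  exact (hf.fderiv_right hmn).clm_apply contDiff_const

theorem hasDerivAt_pdx {f : ℝ × ℝ → ℝ} (hf : Differentiable ℝ f) (x t : ℝ) :
    HasDerivAt (fun y => f (y, t)) (pdx f x t) x :=
  (hasDerivAt_slice_fst hf x t).differentiableAt.hasDerivAt

theorem hasDerivAt_pdt {f : ℝ × ℝ → ℝ} (hf : Differentiable ℝ f) (x t : ℝ) :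
    HasDerivAt (fun s => f (x, s)) (pdt f x t) t :=
  (hasDerivAt_slice_snd hf x t).differentiableAt.hasDerivAt

/-- The mixed second partial derivatives of a `C²` function agree. -/
theorem pdt_pdx_comm {f : ℝ × ℝ → ℝ} (hf : ContDiff ℝ 2 f) (x t : ℝ) :
    pdt (fun p => pdx f p.1 p.2) x t = pdx (fun p => pdt f p.1 p.2) x t := by
  have hd : Differentiable ℝ f := hf.differentiable (by norm_num)
  have hd' : Differentiable ℝ (fderiv ℝ f) :=
    (hf.fderiv_right (m := 1) (by norm_num)).differentiable (by norm_num)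
  have hsymm : IsSymmSndFDerivAt ℝ f (x, t) :=
    hf.contDiffAt.isSymmSndFDerivAt (by simp)
  have happly (v : ℝ × ℝ) : Differentiable ℝ fun p => fderiv ℝ f p v :=
    hd'.clm_apply (differentiable_const v)
  have hsnd (v w : ℝ × ℝ) :
      fderiv ℝ (fun p => fderiv ℝ f p v) (x, t) w = fderiv ℝ (fderiv ℝ f) (x, t) w v := by
    rw [fderiv_clm_apply (hd' _) (differentiableAt_const v)]
    simp
  rw [pdx_eq_fderiv hd, pdt_eq_fderiv hd, pdt, pdx,
    (hasDerivAt_slice_snd (happly (1, 0)) x t).deriv,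
    (hasDerivAt_slice_fst (happly (0, 1)) x t).deriv, hsnd, hsnd]
  exact hsymm _ _

theorem eq_of_hasDerivAt_zero_of_nonneg {g g' : ℝ → ℝ} (hg : ∀ t, HasDerivAt g (g' t) t)
    (hg' : ∀ t, 0 ≤ t → g' t = 0) {t : ℝ} (ht : 0 ≤ t) : g t = g 0 :=
  constant_of_has_deriv_right_zero (fun s _ => (hg s).continuousAt.continuousWithinAt)
    (fun s hs => hg' s hs.1 ▸ (hg s).hasDerivWithinAt) t ⟨ht, le_rfl⟩

/-- Lemma 2.2: the reformulated Vlasov–Poisson system `RP^λ` implies the original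
Poisson equation for all times iff the potential and its time derivative satisfy
the two Poisson equations at the initial time. -/
theorem poisson_iff_initial_poisson
    (lam : ℝ) (hlam : 0 < lam)
    (ρ J S φ : ℝ × ℝ → ℝ)
    (hρ : ContDiff ℝ 4 ρ) (hJ : ContDiff ℝ 4 J) (hS : ContDiff ℝ 4 S)
    (hφ : ContDiff ℝ 4 φ)
    (hcont : ∀ x t : ℝ, 0 ≤ t → pdt ρ x t + pdx J x t = 0)
    (hmom : ∀ x t : ℝ, 0 ≤ t → pdt J x t + pdx S x t = ρ (x, t) * pdx φ x t)
    (hrpe : ∀ x t : ℝ, 0 ≤ t →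
      lam ^ 2 * pdttxx φ x t + pdx (fun p => ρ p * pdx φ p.1 p.2) x t = pdxx S x t) :
    (∀ x t : ℝ, 0 ≤ t → lam ^ 2 * pdxx φ x t = ρ (x, t) - 1) ↔
      (∀ x : ℝ, lam ^ 2 * pdxx φ x 0 = ρ (x, 0) - 1 ∧
        lam ^ 2 * pdtxx φ x 0 = -(pdx J x 0)) := by
  have hxφ := contDiff_pdx (m := 3) hφ (by norm_num)
  have hxxφ : ContDiff ℝ 2 fun p : ℝ × ℝ => pdxx φ p.1 p.2 := contDiff_pdx hxφ (by norm_num)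
  have htxxφ : ContDiff ℝ 1 fun p : ℝ × ℝ => pdtxx φ p.1 p.2 := contDiff_pdt hxxφ (by norm_num)
  have hxJ := contDiff_pdx (m := 3) hJ (by norm_num)
  have htJ := contDiff_pdt (m := 3) hJ (by norm_num)
  have hxS := contDiff_pdx (m := 3) hS (by norm_num)
  have hD (x t : ℝ) : HasDerivAt (fun s => lam ^ 2 * pdxx φ x s - ρ (x, s))
      (lam ^ 2 * pdtxx φ x t - pdt ρ x t) t :=
    ((hasDerivAt_pdt (hxxφ.differentiable (by norm_num)) x t).const_mul _).sub
      (hasDerivAt_pdt (hρ.differentiable (by norm_num)) x t)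
  have hE (x t : ℝ) : HasDerivAt (fun s => lam ^ 2 * pdtxx φ x s + pdx J x s)
      (lam ^ 2 * pdttxx φ x t + pdt (fun p => pdx J p.1 p.2) x t) t :=
    ((hasDerivAt_pdt (htxxφ.differentiable (by norm_num)) x t).const_mul _).add
      (hasDerivAt_pdt (hxJ.differentiable (by norm_num)) x t)
  have hE0 (x t : ℝ) (ht : 0 ≤ t) :
      lam ^ 2 * pdttxx φ x t + pdt (fun p => pdx J p.1 p.2) x t = 0 := by
    have hsum : pdx (fun p => ρ p * pdx φ p.1 p.2) x t =
        pdx (fun p => pdt J p.1 p.2) x t + pdxx S x t := by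
      have hfun : (fun y => ρ (y, t) * pdx φ y t) = fun y => pdt J y t + pdx S y t :=
        funext fun y => (hmom y t ht).symm
      exact (congrArg (fun g => deriv g x) hfun).trans
        ((hasDerivAt_pdx (htJ.differentiable (by norm_num)) x t).add
          (hasDerivAt_pdx (hxS.differentiable (by norm_num)) x t)).deriv
    rw [pdt_pdx_comm (hJ.of_le (by norm_num))]
    linarith [hrpe x t ht]
  constructor
  · intro h x
    refine ⟨h x 0 le_rfl, ?_⟩
    have hconst : HasDerivWithinAt (fun s => lam ^ 2 * pdxx φ x s - ρ (x, s)) 0 (Set.Ici 0) 0 :=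
      (hasDerivWithinAt_const 0 (Set.Ici 0) (-1 : ℝ)).congr
        (fun s hs => by linarith [h x s hs]) (by linarith [h x 0 le_rfl])
    have hzero := (uniqueDiffOn_Ici (0 : ℝ) 0 Set.self_mem_Ici).eq_deriv _
      (hD x 0).hasDerivWithinAt hconst
    linarith [hcont x 0 le_rfl]
  · intro h x t ht
    have hEt (s : ℝ) (hs : 0 ≤ s) : lam ^ 2 * pdtxx φ x s - pdt ρ x s = 0 := by
      have hs0 := eq_of_hasDerivAt_zero_of_nonneg (hE x) (hE0 x) hs
      linarith [hcont x s hs, (h x).2]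
    have ht0 := eq_of_hasDerivAt_zero_of_nonneg (hD x) hEt ht
    linarith [(h x).1]
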